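/- Let k ⊆ K be a field extension with algebraic closure K̄ of K, and let λ_1, …, λ_m be distinct k-algebra embeddings of K into K̄. Suppose |k| > m. If (i_1, …, i_m) ∈ {1,…,m}^m is a tuple whose underlying multiset {i_1,…,i_m} is not equal to {1,…,m} (i.e. has repetitions), then there exists a ∈ K such that ∏_{j=1}^m λ_j(a) ≠ ∏_{j=1}^m λ_{i_j}(a). -/

import Mathlib

/-- A ring homomorphism between fields that differs from each of finitely many others differs from
all of them at a single point. -/
theorem exists_forall_ringHom_apply_ne {ι K L : Type*} [Finite ι] [Field K] [Field L]
    (f : K →+* L) (g : ι → K →+* L) (hg : ∀ i, g i ≠ f) : ∃ a, ∀ i, g i a ≠ f a := by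
  rcases finite_or_infinite K with hK | hK
  · obtain ⟨u, hu⟩ := IsCyclic.exists_generator (α := Kˣ)
    refine ⟨u, fun i hi => hg i (RingHom.ext fun x => ?_)⟩
    rcases eq_or_ne x 0 with rfl | hx
    · simp
    · obtain ⟨n, hn⟩ := Subgroup.mem_zpowers_iff.mp (hu (Units.mk0 x hx))
      have hxn : x = (u : K) ^ n := by
        rw [← Units.val_zpow_eq_zpow_val, hn, Units.val_mk0]
      rw [hxn, map_zpow₀, map_zpow₀, hi]
  · by_contra! hcover
    have := Fintype.ofFinite ι
    obtain ⟨i, -, hi⟩ := AddSubgroup.exists_finiteIndex_of_leftCoset_cover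
      (s := Finset.univ) (g := fun _ : ι => (0 : K))
      (H := fun i => ((g i).eqLocusField f).toSubring.toAddSubgroup) (by
        refine Set.eq_univ_of_forall fun a => ?_
        obtain ⟨i, hi⟩ := hcover a
        simp only [Set.mem_iUnion]
        exact ⟨i, Finset.mem_univ i, a, hi, zero_add a⟩)
    set F := ((g i).eqLocusField f).toSubring.toAddSubgroup
    have hquot : Finite (K ⧸ F) := AddSubgroup.finite_quotient_of_finiteIndex
    obtain ⟨x, hx⟩ : ∃ x, g i x ≠ f x := by
      by_contra! h
      exact hg i (RingHom.ext h)
    have hF : Finite F := by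
      refine Finite.of_injective (fun c : F => (QuotientAddGroup.mk (c * x : K) : K ⧸ F))
        fun c d hcd => ?_
      have hc : g i c = f c := c.2
      have hd : g i d = f d := d.2
      have h : g i (-(c * x) + d * x) = f (-(c * x) + d * x) := QuotientAddGroup.eq.mp hcd
      simp only [map_add, map_neg, map_mul, hc, hd] at h
      have h' : (f d - f c) * (g i x - f x) = 0 := by linear_combination h
      rcases mul_eq_zero.mp h' with h' | h'
      · exact Subtype.ext (f.injective (sub_eq_zero.mp h').symm)
      · exact absurd (sub_eq_zero.mp h') hx
    have : Finite K := Finite.of_equiv _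
      (AddSubgroup.addGroupEquivQuotientProdAddSubgroup (s := F)).symm
    exact not_finite K

open Polynomial in
/-- If the products of two families of `m` algebra homomorphisms agree at all points, then so do
the polynomials with roots the negated values, provided the base field has more than `m`
elements. -/
theorem AlgHom.prod_X_add_C_eq {ι k K L : Type*} [Fintype ι] [Field k] [Field K] [Field L]
    [Algebra k K] [Algebra k L] (f g : ι → K →ₐ[k] L)
    (hcard : (Fintype.card ι : Cardinal) < Cardinal.mk k)
    (h : ∀ a, ∏ j, f j a = ∏ j, g j a) (a : K) :
    ∏ j, (X + C (f j a)) = ∏ j, (X + C (g j a)) := by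
  obtain ⟨s, hs⟩ : ∃ s : Finset k, Fintype.card ι = s.card :=
    Cardinal.exists_finset_eq_card hcard.le
  have hmonic (e : ι → K →ₐ[k] L) : (∏ j, (X + C (e j a))).Monic :=
    monic_prod_of_monic _ _ fun j _ => monic_X_add_C _
  have hdegree (e : ι → K →ₐ[k] L) : (∏ j, (X + C (e j a))).degree = (s.card : WithBot ℕ) := by
    simp [degree_prod, hs]
  have heval (e : ι → K →ₐ[k] L) (c : k) :
      (∏ j, (X + C (e j a))).eval (algebraMap k L c) = ∏ j, e j (algebraMap k K c + a) := by
    simp [eval_prod]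
  refine eq_of_degree_le_of_eval_index_eq s (algebraMap k L).injective.injOn (hdegree f).le
    ((hdegree f).trans (hdegree g).symm)
    ((hmonic f).leadingCoeff.trans (hmonic g).leadingCoeff.symm) fun c _ => ?_
  rw [heval, heval, h]

/-- STATEMENT 14: if `λ_1, …, λ_m` are distinct `k`-algebra embeddings of `K` into an
algebraic closure `K̄` of `K`, `|k| > m`, and `(i_1, …, i_m)` is a tuple from `{1, …, m}`
whose underlying multiset is not `{1, …, m}`, then there is `a ∈ K` with
`Π_j λ_j(a) ≠ Π_j λ_{i_j}(a)`. -/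
theorem exists_distinguishing_element
    (k K Kbar : Type) [Field k] [Field K] [Field Kbar]
    [Algebra k K] [Algebra K Kbar] [Algebra k Kbar] [IsScalarTower k K Kbar]
    [IsAlgClosure K Kbar]
    (m : ℕ) (hm : 0 < m) (lam : Fin m → (K →ₐ[k] Kbar))
    (hdist : Function.Injective lam)
    (hcard : (m : Cardinal) < Cardinal.mk k)
    (t : Fin m → Fin m) (ht : ¬ Function.Bijective t) :
    ∃ a : K, (∏ j, lam j a) ≠ ∏ j, lam (t j) a := by
  obtain ⟨l, hl⟩ : ∃ l, ∀ j, t j ≠ l := by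
    by_contra! h
    exact ht (Finite.surjective_iff_bijective.mp h)
  obtain ⟨a, ha⟩ := exists_forall_ringHom_apply_ne (lam l).toRingHom (fun j => (lam (t j)).toRingHom)
    fun j hj => hl j (hdist (AlgHom.ext fun x => RingHom.congr_fun hj x))
  by_contra! h
  have hpoly := congr_arg (Polynomial.eval (-lam l a))
    (AlgHom.prod_X_add_C_eq lam (fun j => lam (t j)) (by simpa using hcard) h a)
  simp only [Polynomial.eval_prod, Polynomial.eval_add, Polynomial.eval_X,
    Polynomial.eval_C] at hpoly
  rw [Finset.prod_eq_zero (Finset.mem_univ l) (neg_add_cancel _), eq_comm,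
    Finset.prod_eq_zero_iff] at hpoly
  obtain ⟨j, -, hj⟩ := hpoly
  exact ha j (neg_add_eq_zero.mp hj).symm
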